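/- Let f ∈ MvPolynomial (Fin 3) K be irreducible and non-cylindrical, and let q₁ : Fin 3 → RatFunc K have some component not in the image of algebraMap K (RatFunc K) (the curve parametrization P₁ is nonconstant). Let F := f(X + P₁) ∈ MvPolynomial (Fin 3) (RatFunc K). Then there do not exist A ∈ MvPolynomial (Fin 3) K and c ∈ RatFunc K such that F = c • (the coefficient-wise image of A in MvPolynomial (Fin 3) (RatFunc K)). (Lemma 3.4, statements 2 and 3: in the factorization f(P₁(t₁)+x) = h̃(x)·Ψ(x,t₁)·p(t₁), the factor Ψ lies neither in K[x] nor in K[t₁], i.e. f(P₁(t₁)+x) is not a product of a polynomial in x alone and a rational function of t₁ alone.) -/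

import Mathlib

noncomputable section

/-- `f` is non-cylindrical if no nonzero constant directional derivative of `f` vanishes. -/
def NonCylindrical {K : Type*} [Field K] (f : MvPolynomial (Fin 3) K) : Prop :=
  ∀ a : Fin 3 → K, a ≠ 0 → (∑ i, a i • MvPolynomial.pderiv i f) ≠ 0

/-- `f(X + P₁)`: map the coefficients of `f` into `RatFunc K` and substitute
`Xᵢ ↦ Xᵢ + q₁ i`. -/
def shiftedPoly {K : Type*} [Field K] (f : MvPolynomial (Fin 3) K)
    (q₁ : Fin 3 → RatFunc K) : MvPolynomial (Fin 3) (RatFunc K) :=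
  (MvPolynomial.aeval fun i => MvPolynomial.X i + MvPolynomial.C (q₁ i))
    (MvPolynomial.map (algebraMap K (RatFunc K)) f)

open Polynomial in
theorem RatFunc.exists_derivation_algebraMap (K : Type*) [Field K] :
    ∃ D : Derivation K (RatFunc K) (RatFunc K),
      ∀ p : K[X], D (algebraMap K[X] (RatFunc K) p) =
        algebraMap K[X] (RatFunc K) (derivative p) := by
  have : Algebra.FormallyEtale K[X] (RatFunc K) :=
    Algebra.FormallyEtale.of_isLocalization (nonZeroDivisors K[X])
  refine ⟨(((Algebra.linearMap K[X] (RatFunc K)) ∘ₗ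
    (KaehlerDifferential.polynomialEquiv K).toLinearMap).liftBaseChange (RatFunc K) ∘ₗ
    (KaehlerDifferential.tensorKaehlerEquivOfFormallyEtale
      K K[X] (RatFunc K)).symm.toLinearMap).compDer (KaehlerDifferential.D K (RatFunc K)), ?_⟩
  intro p
  simp [KaehlerDifferential.tensorKaehlerEquivOfFormallyEtale_symm_D_algebraMap]

open Polynomial in
/-- In characteristic zero, some derivation of `K(t)` over `K` has `K` as its constants. -/
theorem RatFunc.exists_derivation_mem_range (K : Type*) [Field K] [CharZero K] :
    ∃ D : Derivation K (RatFunc K) (RatFunc K),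
      ∀ q, D q = 0 → q ∈ Set.range (algebraMap K (RatFunc K)) := by
  obtain ⟨D, hD⟩ := RatFunc.exists_derivation_algebraMap K
  refine ⟨D, fun q hq => ?_⟩
  have hmul : algebraMap K[X] (RatFunc K) q.denom * q = algebraMap K[X] (RatFunc K) q.num := by
    have hd := RatFunc.algebraMap_ne_zero q.denom_ne_zero
    rw [mul_comm]
    exact ((div_eq_iff hd).mp q.num_div_denom).symm
  have hder : q * algebraMap K[X] (RatFunc K) (derivative q.denom) =
      algebraMap K[X] (RatFunc K) (derivative q.num) := by
    have := congrArg D hmul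
    simpa [hD, hq] using this
  have hpoly : q.num * derivative q.denom = q.denom * derivative q.num := by
    apply RatFunc.algebraMap_injective K
    rw [map_mul, map_mul, ← hmul, ← hder]
    ring
  have hdvd : q.denom ∣ derivative q.denom :=
    q.isCoprime_num_denom.symm.dvd_of_dvd_mul_left (Dvd.intro _ hpoly.symm)
  have hdenom : derivative q.denom = 0 := by
    by_contra hne
    exact (degree_derivative_lt q.denom_ne_zero).not_ge (degree_le_of_dvd hdvd hne)
  have hnum : derivative q.num = 0 := by
    simpa [hdenom, q.denom_ne_zero] using hpoly.symm
  rw [eq_C_of_derivative_eq_zero hdenom, eq_C_of_derivative_eq_zero hnum] at hmul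
  have hd0 : q.denom.coeff 0 ≠ 0 := fun h => q.denom_ne_zero <| by
    rw [eq_C_of_derivative_eq_zero hdenom, h, C_0]
  refine ⟨q.num.coeff 0 / q.denom.coeff 0, ?_⟩
  rw [map_div₀, div_eq_iff (by simpa using hd0), mul_comm]
  simpa using hmul.symm

namespace MvPolynomial

theorem derivation_aeval {σ R A : Type*} [Fintype σ] [CommRing R] [CommRing A] [Algebra R A]
    (D : Derivation R A A) (v : σ → A) (f : MvPolynomial σ R) :
    D (aeval v f) = ∑ i, D (v i) * aeval v (pderiv i f) := by
  classical
  induction f using MvPolynomial.induction_on with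
  | C a => simp
  | add p q hp hq => simp [hp, hq, mul_add, Finset.sum_add_distrib]
  | mul_X p j hp =>
    simp only [map_mul, aeval_X, Derivation.leibniz, hp, smul_eq_mul, map_add, pderiv_X, mul_add,
      Finset.sum_add_distrib, Finset.mul_sum]
    congr 1
    · rw [Finset.sum_eq_single j]
      · simp [mul_comm]
      · intro i _ hij
        simp [Pi.single_eq_of_ne hij.symm]
      · simp
    · exact Finset.sum_congr rfl fun i _ => by ring

theorem coeff_pderiv_eq_zero_of_totalDegree_le {σ R : Type*} [CommSemiring R]
    {f : MvPolynomial σ R} {m : σ →₀ ℕ} (hm : f.totalDegree ≤ m.degree) (i : σ) :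
    coeff m (pderiv i f) = 0 := by
  rw [coeff_pderiv, coeff_eq_zero_of_totalDegree_lt, zero_mul]
  change _ < (m + Finsupp.single i 1).degree
  rw [map_add, Finsupp.degree_single]
  omega

end MvPolynomial

theorem eval_shiftedPoly {K : Type*} [Field K] (f : MvPolynomial (Fin 3) K)
    (q x : Fin 3 → RatFunc K) :
    MvPolynomial.eval x (shiftedPoly f q) = MvPolynomial.aeval (x + q) f := by
  rw [shiftedPoly, MvPolynomial.aeval_map_algebraMap]
  induction f using MvPolynomial.induction_on with
  | C a => simp [MvPolynomial.algebraMap_apply]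
  | add p r hp hr => simp [hp, hr]
  | mul_X p j hp => simp [hp]

theorem eq_zero_of_shiftedPoly_eq_zero {K : Type*} [Field K] [Infinite K]
    {f : MvPolynomial (Fin 3) K} {q : Fin 3 → RatFunc K} (h : shiftedPoly f q = 0) : f = 0 := by
  apply MvPolynomial.funext
  intro x
  apply (algebraMap K (RatFunc K)).injective
  have := eval_shiftedPoly f q ((fun i => algebraMap K (RatFunc K) (x i)) - q)
  rw [h, sub_add_cancel, map_zero] at this
  rw [map_zero, map_zero, this]
  exact (MvPolynomial.aeval_algebraMap_apply _ _ _).symm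

/-- A polynomial relation between `f(X + q)` and a separated product forces a linear relation
between `f` and its partial derivatives. -/
theorem smul_sum_derivation_smul_pderiv {K : Type*} [Field K] [Infinite K]
    (D : Derivation K (RatFunc K) (RatFunc K)) {f A : MvPolynomial (Fin 3) K}
    {q : Fin 3 → RatFunc K} {c : RatFunc K}
    (h : shiftedPoly f q = c • MvPolynomial.map (algebraMap K (RatFunc K)) A) :
    c • ∑ i, D (q i) • MvPolynomial.map (algebraMap K (RatFunc K)) (MvPolynomial.pderiv i f) =
      D c • MvPolynomial.map (algebraMap K (RatFunc K)) f := by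
  have hinf : (Set.range (algebraMap K (RatFunc K))).Infinite :=
    Set.infinite_range_of_injective (algebraMap K (RatFunc K)).injective
  have hinf' : ∀ i, ((fun y => y + q i) '' Set.range (algebraMap K (RatFunc K))).Infinite :=
    fun i => hinf.image (add_left_injective (q i)).injOn
  apply MvPolynomial.funext_set _ hinf'
  intro y hy
  have hy' : ∀ i, ∃ a : K, algebraMap K (RatFunc K) a + q i = y i := by
    intro i
    obtain ⟨_, ⟨a, rfl⟩, ha⟩ := hy i (Set.mem_univ i)
    exact ⟨a, ha⟩
  choose x hx using hy'
  obtain rfl : (fun i => algebraMap K (RatFunc K) (x i)) + q = y := funext hx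
  have hval : MvPolynomial.aeval ((fun i => algebraMap K (RatFunc K) (x i)) + q) f =
      c * algebraMap K (RatFunc K) (MvPolynomial.aeval x A) := by
    rw [← eval_shiftedPoly, h, MvPolynomial.smul_eval, MvPolynomial.eval_map,
      ← MvPolynomial.aeval_algebraMap_apply]
    rfl
  have hder := MvPolynomial.derivation_aeval D
    ((fun i => algebraMap K (RatFunc K) (x i)) + q) f
  rw [hval] at hder
  simp only [Derivation.leibniz, Derivation.map_algebraMap, zero_add, Pi.add_apply,
    map_add, smul_eq_mul] at hder
  simp only [MvPolynomial.smul_eval, map_sum, MvPolynomial.eval_map, ← MvPolynomial.aeval_def]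
  rw [← hder, hval]
  ring

/-- Lemma 3.4, statements 2 and 3: for a nonconstant curve `P₁`, the polynomial
`f(P₁(t₁) + x)` is not a product of a polynomial in `x` alone (with coefficients in `K`)
and a rational function of `t₁` alone. -/
theorem shifted_poly_not_separable
    (K : Type*) [Field K] [IsAlgClosed K] [CharZero K]
    (f : MvPolynomial (Fin 3) K) (hf : Irreducible f) (hnc : NonCylindrical f)
    (q₁ : Fin 3 → RatFunc K)
    (hq₁ : ∃ i, q₁ i ∉ Set.range (algebraMap K (RatFunc K)))
    (F : MvPolynomial (Fin 3) (RatFunc K)) (hF : F = shiftedPoly f q₁) :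
    ¬ ∃ (A : MvPolynomial (Fin 3) K) (c : RatFunc K),
        F = c • MvPolynomial.map (algebraMap K (RatFunc K)) A := by
  rintro ⟨A, c, hA⟩
  obtain ⟨D, hD⟩ := RatFunc.exists_derivation_mem_range K
  obtain ⟨j, hj⟩ := hq₁
  have hf0 : f ≠ 0 := hf.ne_zero
  have hc : c ≠ 0 := by
    rintro rfl
    exact hf0 (eq_zero_of_shiftedPoly_eq_zero (q := q₁) (by rw [← hF, hA, zero_smul]))
  have hrel := smul_sum_derivation_smul_pderiv D (hF.symm.trans hA)
  have hcoeff : ∀ m, c * ∑ i, D (q₁ i) *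
      algebraMap K (RatFunc K) (MvPolynomial.coeff m (MvPolynomial.pderiv i f)) =
      D c * algebraMap K (RatFunc K) (MvPolynomial.coeff m f) := by
    intro m
    simpa [MvPolynomial.coeff_sum, MvPolynomial.coeff_map] using
      congrArg (MvPolynomial.coeff m) hrel
  have hDc : D c = 0 := by
    obtain ⟨m, hm, hmdeg⟩ := Finset.exists_mem_eq_sup f.support
      (MvPolynomial.support_nonempty.mpr hf0) (fun s => s.sum fun _ e => e)
    have hle : f.totalDegree ≤ m.degree := hmdeg.le
    have := hcoeff m
    simp only [MvPolynomial.coeff_pderiv_eq_zero_of_totalDegree_le hle, map_zero, mul_zero,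
      Finset.sum_const_zero] at this
    simpa [MvPolynomial.mem_support_iff.mp hm] using this.symm
  have hzero : ∀ m, ∑ i, D (q₁ i) *
      algebraMap K (RatFunc K) (MvPolynomial.coeff m (MvPolynomial.pderiv i f)) = 0 := by
    intro m
    simpa [hDc, hc] using hcoeff m
  obtain ⟨φ, hφ⟩ : ∃ φ : Module.Dual K (RatFunc K), φ (D (q₁ j)) ≠ 0 := by
    by_contra! h
    exact hj (hD _ ((Module.forall_dual_apply_eq_zero_iff K _).mp h))
  refine hnc (fun i => φ (D (q₁ i))) (fun h => hφ (congrFun h j)) ?_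
  ext m
  have := congrArg φ (hzero m)
  simp only [mul_comm _ (algebraMap K (RatFunc K) _), ← Algebra.smul_def, map_sum, map_smul,
    map_zero] at this
  simpa [MvPolynomial.coeff_sum, mul_comm (φ _)] using this
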